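/- Let n > 1 and let L be the second order cone in ℝ^n. A matrix A ∈ ℝ^{n×n} is a Z-transformation on L if and only if there exists a real number γ such that the symmetric matrix γ·J − (JA + AᵀJ) is positive semidefinite, where J = diag(1,−1,…,−1). -/

import Mathlib

open Matrix

noncomputable section

/-- The second order cone in `ℝⁿ`: `{(t,u) : t ≥ ‖u‖}` (first coordinate is `t`). -/
def soc (n : ℕ) [NeZero n] : Set (Fin n → ℝ) :=
  {x | Real.sqrt (∑ i, if i = 0 then 0 else (x i) ^ 2) ≤ x 0}

/-- The boundary of the second order cone: `{(t,u) : t = ‖u‖}`. -/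
def socBd (n : ℕ) [NeZero n] : Set (Fin n → ℝ) :=
  {x | Real.sqrt (∑ i, if i = 0 then 0 else (x i) ^ 2) = x 0}

/-- `J = diag(1, -1, …, -1)`. -/
def Jmat (n : ℕ) [NeZero n] : Matrix (Fin n) (Fin n) ℝ :=
  Matrix.diagonal (fun i => if i = 0 then 1 else -1)

/-- The dual cone of a set `K ⊆ ℝⁿ`. -/
def dualCone {n : ℕ} (K : Set (Fin n → ℝ)) : Set (Fin n → ℝ) :=
  {y | ∀ x ∈ K, 0 ≤ x ⬝ᵥ y}

/-- `A` is a Z-transformation on `K`: `x ∈ K`, `y ∈ K*`, `⟨x,y⟩ = 0` imply `⟨Ax,y⟩ ≤ 0`. -/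
def IsZTransf {n : ℕ} (K : Set (Fin n → ℝ)) (A : Matrix (Fin n) (Fin n) ℝ) : Prop :=
  ∀ x ∈ K, ∀ y ∈ dualCone K, x ⬝ᵥ y = 0 → (A.mulVec x) ⬝ᵥ y ≤ 0

/-- The completely positive cone of `C`: all finite sums `∑ uᵢuᵢᵀ` with `uᵢ ∈ C`. -/
def cpCone {n : ℕ} (C : Set (Fin n → ℝ)) : Set (Matrix (Fin n) (Fin n) ℝ) :=
  {X | ∃ (m : ℕ) (u : Fin m → Fin n → ℝ), (∀ i, u i ∈ C) ∧ X = ∑ i, vecMulVec (u i) (u i)}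

/-- The copositive cone of `C`: symmetric matrices `A` with `xᵀAx ≥ 0` for all `x ∈ C`. -/
def copCone {n : ℕ} (C : Set (Fin n → ℝ)) : Set (Matrix (Fin n) (Fin n) ℝ) :=
  {A | Aᵀ = A ∧ ∀ x ∈ C, 0 ≤ x ⬝ᵥ A.mulVec x}

/-- `Ω = {(x,y) ∈ L × L : ‖x‖ = 1 = ‖y‖, ⟨x,y⟩ = 0}`. -/
def OmegaSet (n : ℕ) [NeZero n] : Set ((Fin n → ℝ) × (Fin n → ℝ)) :=
  {p | p.1 ∈ soc n ∧ p.2 ∈ soc n ∧ Real.sqrt (∑ i, p.1 i ^ 2) = 1 ∧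
       Real.sqrt (∑ i, p.2 i ^ 2) = 1 ∧ p.1 ⬝ᵥ p.2 = 0}

/-- `γ(A) = max {⟨Ax,y⟩ : (x,y) ∈ Ω}`. -/
def gammaFun (n : ℕ) [NeZero n] (A : Matrix (Fin n) (Fin n) ℝ) : ℝ :=
  sSup {r | ∃ p ∈ OmegaSet n, r = (A.mulVec p.1) ⬝ᵥ p.2}

theorem QuadraticMap.map_smul_add_smul {V : Type*} [AddCommGroup V] [Module ℝ V]
    (Q : QuadraticForm ℝ V) (a b : ℝ) (x y : V) :
    Q (a • x + b • y) = a ^ 2 * Q x + b ^ 2 * Q y + a * b * QuadraticMap.polar Q x y := by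
  rw [QuadraticMap.map_add Q, QuadraticMap.map_smul, QuadraticMap.map_smul,
    QuadraticMap.polar_smul_left, QuadraticMap.polar_smul_right]
  simp only [smul_eq_mul]
  ring

/-- If `Q` is nonnegative on the zero set of `q`, then the slopes `-Q/q` on `{q > 0}` are bounded
by those on `{q < 0}`. -/
theorem QuadraticForm.cross_nonneg_of_nonneg_on_null {V : Type*} [AddCommGroup V] [Module ℝ V]
    {Q q : QuadraticForm ℝ V} (h : ∀ x, q x = 0 → 0 ≤ Q x) {x y : V} (hx : 0 < q x)
    (hy : q y < 0) : 0 ≤ -q y * Q x + q x * Q y := by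
  set a := q x
  set p := QuadraticMap.polar q x y
  obtain ⟨b, hb⟩ : ∃ b, q y = -b := ⟨-q y, by ring⟩
  have hb0 : 0 < b := by linarith
  have hdisc : 0 ≤ p ^ 2 + 4 * a * b := by positivity
  obtain ⟨t, ht⟩ : ∃ t : ℝ, a + t * p - b * t ^ 2 = 0 := by
    refine ⟨(p + Real.sqrt (p ^ 2 + 4 * a * b)) / (2 * b), ?_⟩
    have hr := Real.sq_sqrt hdisc
    set r := Real.sqrt (p ^ 2 + 4 * a * b)
    field_simp
    linear_combination -hr
  have h₁ := h ((1 : ℝ) • x + t • y) (by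
    rw [QuadraticMap.map_smul_add_smul, hb]; linear_combination ht)
  have h₂ := h ((b * t) • x + (-a) • y) (by
    rw [QuadraticMap.map_smul_add_smul, hb]; linear_combination (-a * b) * ht)
  rw [QuadraticMap.map_smul_add_smul] at h₁ h₂
  have hpos : 0 < a + b * t ^ 2 := by positivity
  rw [hb, neg_neg]
  refine nonneg_of_mul_nonneg_right (?_ : 0 ≤ (a + b * t ^ 2) * _) hpos
  have := mul_nonneg (mul_pos hx hb0).le h₁
  linear_combination this + h₂

/-- The S-lemma with an equality constraint, for an indefinite constraint form. -/
theorem QuadraticForm.exists_nonneg_add_mul {V : Type*} [AddCommGroup V] [Module ℝ V]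
    {Q q : QuadraticForm ℝ V} (h : ∀ x, q x = 0 → 0 ≤ Q x) (hpos : ∃ x, 0 < q x)
    (hneg : ∃ x, q x < 0) : ∃ c : ℝ, ∀ x, 0 ≤ Q x + c * q x := by
  have key : ∀ x y, 0 < q x → q y < 0 → -Q x / q x ≤ Q y / -q y := by
    intro x y hx hy
    rw [div_le_div_iff₀ hx (neg_pos.2 hy)]
    linarith [QuadraticForm.cross_nonneg_of_nonneg_on_null h hx hy]
  let S : Set ℝ := {r | ∃ x, 0 < q x ∧ r = -Q x / q x}
  obtain ⟨x₀, hx₀⟩ := hpos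
  obtain ⟨y₀, hy₀⟩ := hneg
  have hS : S.Nonempty := ⟨_, x₀, hx₀, rfl⟩
  have hbdd : BddAbove S := ⟨Q y₀ / -q y₀, by rintro _ ⟨x, hx, rfl⟩; exact key x y₀ hx hy₀⟩
  refine ⟨sSup S, fun x => ?_⟩
  rcases lt_trichotomy (q x) 0 with hx | hx | hx
  · have : sSup S ≤ Q x / -q x :=
      csSup_le hS (by rintro _ ⟨z, hz, rfl⟩; exact key z x hz hx)
    rw [le_div_iff₀ (neg_pos.2 hx)] at this
    linarith
  · simpa [hx] using h x hx
  · have : -Q x / q x ≤ sSup S := le_csSup hbdd ⟨x, hx, rfl⟩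
    rw [div_le_iff₀ hx] at this
    linarith

/-- The inner product of the parts of `x` and `y` outside the first coordinate. -/
def tailDot {n : ℕ} [NeZero n] (x y : Fin n → ℝ) : ℝ :=
  ∑ i, if i = 0 then 0 else x i * y i

section SecondOrderCone

variable {n : ℕ} [NeZero n]

theorem dotProduct_eq_add_tailDot (x y : Fin n → ℝ) : x ⬝ᵥ y = x 0 * y 0 + tailDot x y := by
  have h : ∀ i, x i * y i =
      (if i = 0 then x 0 * y 0 else 0) + (if i = 0 then 0 else x i * y i) := by
    intro i
    split_ifs with hi <;> simp [hi]
  rw [dotProduct, Finset.sum_congr rfl fun i _ => h i, Finset.sum_add_distrib]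
  simp [tailDot]

theorem tailDot_self_nonneg (x : Fin n → ℝ) : 0 ≤ tailDot x x :=
  Finset.sum_nonneg fun i _ => by split_ifs <;> nlinarith [mul_self_nonneg (x i)]

theorem tailDot_sq_le (x y : Fin n → ℝ) : tailDot x y ^ 2 ≤ tailDot x x * tailDot y y := by
  have h : ∀ u v : Fin n → ℝ, tailDot u v =
      ∑ i, (if i = 0 then 0 else u i) * (if i = 0 then 0 else v i) := fun u v =>
    Finset.sum_congr rfl fun i _ => by split_ifs <;> simp
  simp only [h, ← sq (ite _ _ _)]
  exact Finset.sum_mul_sq_le_sq_mul_sq _ _ _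

theorem mem_soc_iff {x : Fin n → ℝ} : x ∈ soc n ↔ 0 ≤ x 0 ∧ tailDot x x ≤ x 0 ^ 2 := by
  simp only [soc, Set.mem_ofPred_eq, Real.sqrt_le_iff, tailDot, sq]

theorem Jmat_mulVec (x : Fin n → ℝ) (i : Fin n) :
    (Jmat n *ᵥ x) i = if i = 0 then x i else -x i := by
  rw [Jmat, mulVec_diagonal]
  split_ifs <;> simp

theorem tailDot_Jmat_mulVec_right (x y : Fin n → ℝ) :
    tailDot x (Jmat n *ᵥ y) = -tailDot x y := by
  simp only [tailDot, Jmat_mulVec, ← Finset.sum_neg_distrib]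
  refine Finset.sum_congr rfl fun i _ => ?_
  split_ifs <;> ring

theorem dotProduct_Jmat_mulVec (x y : Fin n → ℝ) :
    x ⬝ᵥ (Jmat n *ᵥ y) = x 0 * y 0 - tailDot x y := by
  rw [dotProduct_eq_add_tailDot, tailDot_Jmat_mulVec_right, Jmat_mulVec]
  simp [sub_eq_add_neg]

theorem tailDot_Jmat_mulVec_left (x y : Fin n → ℝ) :
    tailDot (Jmat n *ᵥ x) y = -tailDot x y := by
  simp only [tailDot, Jmat_mulVec, ← Finset.sum_neg_distrib]
  refine Finset.sum_congr rfl fun i _ => ?_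
  split_ifs <;> ring

theorem Jmat_transpose : (Jmat n)ᵀ = Jmat n := diagonal_transpose _

theorem Jmat_mulVec_mem_soc {x : Fin n → ℝ} (hx : x ∈ soc n) : Jmat n *ᵥ x ∈ soc n := by
  rw [mem_soc_iff] at hx ⊢
  simpa [tailDot_Jmat_mulVec_left, tailDot_Jmat_mulVec_right, Jmat_mulVec] using hx

theorem dualCone_soc : dualCone (soc n) = soc n := by
  ext y
  constructor
  · intro hy
    have hs := tailDot_self_nonneg y
    have hy0 : 0 ≤ y 0 := by
      have := hy (Pi.single 0 1) (mem_soc_iff.2 (by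
        simp only [tailDot, Pi.single_apply]
        refine ⟨by simp, ?_⟩
        rw [Finset.sum_eq_zero fun i _ => by split_ifs <;> simp]
        simp))
      simpa using this
    refine mem_soc_iff.2 ⟨hy0, ?_⟩
    set r := Real.sqrt (tailDot y y)
    have hr : r ^ 2 = tailDot y y := Real.sq_sqrt hs
    have hr0 : 0 ≤ r := Real.sqrt_nonneg _
    let x : Fin n → ℝ := fun i => if i = 0 then r else -y i
    have hxx : tailDot x x = tailDot y y :=
      Finset.sum_congr rfl fun i _ => by simp only [x]; split_ifs <;> ring
    have hxy : tailDot x y = -tailDot y y := by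
      simp only [tailDot, ← Finset.sum_neg_distrib]
      exact Finset.sum_congr rfl fun i _ => by simp only [x]; split_ifs <;> ring
    have hx0 : x 0 = r := by simp [x]
    have := hy x (mem_soc_iff.2 ⟨hx0 ▸ hr0, by rw [hxx, hx0, hr]⟩)
    rw [dotProduct_eq_add_tailDot, hxy, hx0, ← hr] at this
    rw [← hr]
    rcases hr0.eq_or_lt with h | h
    · rw [← h]; nlinarith
    · have : r ≤ y 0 := le_of_mul_le_mul_left (by linarith) h
      gcongr
  · intro hy x hx
    rw [mem_soc_iff] at hx hy
    rw [dotProduct_eq_add_tailDot]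
    have h : tailDot x y ^ 2 ≤ (x 0 * y 0) ^ 2 := by
      rw [mul_pow]
      exact (tailDot_sq_le x y).trans
        (mul_le_mul hx.2 hy.2 (tailDot_self_nonneg y) (sq_nonneg _))
    linarith [(abs_le_of_sq_le_sq' h (mul_nonneg hx.1 hy.1)).1]

/-- Orthogonal vectors of the second order cone are, up to scaling, reflections of each other. -/
theorem smul_eq_smul_Jmat_mulVec_of_orthogonal {x y : Fin n → ℝ} (hx : x ∈ soc n)
    (hy : y ∈ soc n) (hxy : x ⬝ᵥ y = 0) : x 0 • y = y 0 • (Jmat n *ᵥ x) := by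
  rw [mem_soc_iff] at hx hy
  rw [dotProduct_eq_add_tailDot] at hxy
  let z : Fin n → ℝ := x 0 • y + y 0 • x
  have hz : tailDot z z =
      x 0 ^ 2 * tailDot y y + y 0 ^ 2 * tailDot x x + 2 * (x 0 * y 0) * tailDot x y := by
    simp only [tailDot, Finset.mul_sum, ← Finset.sum_add_distrib]
    refine Finset.sum_congr rfl fun i _ => ?_
    simp only [z, Pi.add_apply, Pi.smul_apply, smul_eq_mul]
    split_ifs <;> ring
  have hz0 : tailDot z z = 0 := by
    refine le_antisymm ?_ (tailDot_self_nonneg z)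
    rw [hz, show tailDot x y = -(x 0 * y 0) by linarith]
    nlinarith [mul_le_mul_of_nonneg_left hy.2 (sq_nonneg (x 0)),
      mul_le_mul_of_nonneg_left hx.2 (sq_nonneg (y 0))]
  have hzi := (Finset.sum_eq_zero_iff_of_nonneg fun i _ => by
    split_ifs <;> nlinarith [mul_self_nonneg (z i)]).1 hz0
  ext i
  simp only [Pi.smul_apply, smul_eq_mul, Jmat_mulVec]
  split_ifs with hi
  · rw [hi]; ring
  · have := hzi i (Finset.mem_univ i)
    rw [if_neg hi, mul_self_eq_zero] at this
    simp only [z, Pi.add_apply, Pi.smul_apply, smul_eq_mul] at this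
    linarith

/-- `A` is a Z-transformation on the second order cone iff `⟨Ax, Jx⟩ ≤ 0` whenever
`⟨x, Jx⟩ = 0`. -/
theorem isZTransf_soc_iff {A : Matrix (Fin n) (Fin n) ℝ} :
    IsZTransf (soc n) A ↔
      ∀ x, x ⬝ᵥ (Jmat n *ᵥ x) = 0 → (A *ᵥ x) ⬝ᵥ (Jmat n *ᵥ x) ≤ 0 := by
  rw [IsZTransf, dualCone_soc]
  constructor
  · intro h
    have key : ∀ x : Fin n → ℝ, 0 ≤ x 0 → x ⬝ᵥ (Jmat n *ᵥ x) = 0 →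
        (A *ᵥ x) ⬝ᵥ (Jmat n *ᵥ x) ≤ 0 := by
      intro x hx0 hx
      have hmem : x ∈ soc n := by
        rw [dotProduct_Jmat_mulVec] at hx
        exact mem_soc_iff.2 ⟨hx0, by linarith⟩
      exact h x hmem _ (Jmat_mulVec_mem_soc hmem) hx
    intro x hx
    rcases le_total 0 (x 0) with hx0 | hx0
    · exact key x hx0 hx
    · simpa [mulVec_neg] using key (-x) (by simpa using hx0) (by simpa [mulVec_neg] using hx)
  · intro h x hx y hy hxy
    have hrefl := smul_eq_smul_Jmat_mulVec_of_orthogonal hx hy hxy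
    have hx' := mem_soc_iff.1 hx
    have hy' := mem_soc_iff.1 hy
    rcases hx'.1.eq_or_lt with hx0 | hx0
    · have hxz : tailDot x x = 0 :=
        le_antisymm (by simpa [← hx0] using hx'.2) (tailDot_self_nonneg x)
      have : x = 0 := by
        have hxx : x ⬝ᵥ x = 0 := by rw [dotProduct_eq_add_tailDot, hxz, ← hx0]; ring
        exact dotProduct_self_eq_zero.1 hxx
      simp [this]
    · refine nonpos_of_mul_nonpos_right (?_ : x 0 * _ ≤ 0) hx0
      have hAxy := congrArg (fun z => (A *ᵥ x) ⬝ᵥ z) hrefl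
      have hxz := congrArg (fun z => x ⬝ᵥ z) hrefl
      simp only [dotProduct_smul, smul_eq_mul] at hAxy hxz
      rw [hAxy]
      rw [hxy, mul_zero, eq_comm, mul_eq_zero] at hxz
      rcases hxz with hy0 | hq
      · simp [hy0]
      · exact mul_nonpos_of_nonneg_of_nonpos hy'.1 (h x hq)

theorem dotProduct_lyapunov_mulVec (A : Matrix (Fin n) (Fin n) ℝ) (γ : ℝ) (x : Fin n → ℝ) :
    x ⬝ᵥ ((γ • Jmat n - (Jmat n * A + Aᵀ * Jmat n)) *ᵥ x) =
      γ * (x ⬝ᵥ (Jmat n *ᵥ x)) - 2 * ((A *ᵥ x) ⬝ᵥ (Jmat n *ᵥ x)) := by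
  have h₁ : x ⬝ᵥ (Jmat n *ᵥ (A *ᵥ x)) = (A *ᵥ x) ⬝ᵥ (Jmat n *ᵥ x) := by
    rw [dotProduct_mulVec, ← mulVec_transpose, Jmat_transpose, dotProduct_comm]
  have h₂ : x ⬝ᵥ (Aᵀ *ᵥ (Jmat n *ᵥ x)) = (A *ᵥ x) ⬝ᵥ (Jmat n *ᵥ x) := by
    rw [dotProduct_mulVec, vecMul_transpose]
  simp only [sub_mulVec, add_mulVec, smul_mulVec, dotProduct_sub, dotProduct_add,
    dotProduct_smul, ← mulVec_mulVec, h₁, h₂, smul_eq_mul]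
  ring

end SecondOrderCone

theorem stmt14 (n : ℕ) [NeZero n] (hn : 1 < n) (A : Matrix (Fin n) (Fin n) ℝ) :
    IsZTransf (soc n) A ↔
      ∃ γ : ℝ, (γ • Jmat n - (Jmat n * A + Aᵀ * Jmat n)).PosSemidef := by
  rw [isZTransf_soc_iff]
  constructor
  · intro h
    let M : Matrix (Fin n) (Fin n) ℝ := (0 : ℝ) • Jmat n - (Jmat n * A + Aᵀ * Jmat n)
    have happ : ∀ (N : Matrix (Fin n) (Fin n) ℝ) (x : Fin n → ℝ),
        N.toQuadraticForm' x = x ⬝ᵥ (N *ᵥ x) := fun N x => by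
      exact Matrix.toLinearMap₂'_apply' N x x
    have hM : ∀ x, M.toQuadraticForm' x = -2 * ((A *ᵥ x) ⬝ᵥ (Jmat n *ᵥ x)) := fun x => by
      rw [happ, dotProduct_lyapunov_mulVec]; ring
    have hsingle : ∀ i : Fin n, (Jmat n).toQuadraticForm' (Pi.single i 1) =
        if i = 0 then 1 else -1 := fun i => by
      rw [happ]; simp [Jmat]
    obtain ⟨γ, hγ⟩ := QuadraticForm.exists_nonneg_add_mul
      (Q := M.toQuadraticForm') (q := (Jmat n).toQuadraticForm')
      (fun x hx => by
        rw [happ] at hx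
        rw [hM]
        linarith [h x hx])
      ⟨Pi.single 0 1, by rw [hsingle]; simp⟩
      ⟨Pi.single ⟨1, hn⟩ 1, by
        rw [hsingle, if_neg (by simp [Fin.ext_iff])]
        norm_num⟩
    refine ⟨γ, .of_dotProduct_mulVec_nonneg ?_ fun x => ?_⟩
    · rw [IsHermitian, conjTranspose_eq_transpose_of_trivial]
      simp only [transpose_sub, transpose_smul, transpose_add, transpose_mul, transpose_transpose,
        Jmat_transpose]
      rw [add_comm]
    · have := hγ x
      rw [hM, happ] at this
      rw [star_trivial, dotProduct_lyapunov_mulVec]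
      linarith
  · rintro ⟨γ, hγ⟩ x hx
    have := hγ.dotProduct_mulVec_nonneg x
    rw [star_trivial, dotProduct_lyapunov_mulVec, hx] at this
    linarith
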